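/- Suppose N = exp(G) is even, let m ≥ 1 be the 2-adic valuation of N (so 2^m divides N and 2^{m+1} does not), and let ℓ = φ(N/2^m) where φ is Euler's totient function. Let (u_k)_{k≥1} and (v_k)_{k≥1} be integers coprime to N satisfying: u_k + v_k ≡ 2^k (mod N) for all k ≥ 1; u_1 = v_1 = 1; and u_{k+ℓ} ≡ u_k and v_{k+ℓ} ≡ v_k (mod N) for all k ≥ m. Let f : G → ℂ be rational-valued and x ∈ G with f̂(x) ≠ 0. Then f̂(u·x) ≠ 0 for every integer u coprime to N, and f̂(x)^{2^m·(2^ℓ−1)} = [ ∏_{k=1}^{ℓ+m−1} ( B̂_k / Â_{k+1} )^{2^{ℓ+m−1−k}} ] / [ ∏_{k=1}^{m−1} ( B̂_k / Â_{k+1} )^{2^{m−1−k}} ], where Â_k = M̂_4(f; u_k·x, v_k·x, −u_k·x) = f̂(u_k·x)·f̂(v_k·x)·f̂(−u_k·x)·f̂(−v_k·x) and B̂_k = M̂_6(f; u_k·x, v_k·x, u_k·x, v_k·x, −u_{k+1}·x) = f̂(u_k·x)^2·f̂(v_k·x)^2·f̂(−u_{k+1}·x)·f̂(−v_{k+1}·x).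 -/

import Mathlib

open Complex Finset

/-- The character `χ(x,y) = exp(2πi·Σ_i x_i·y_i/a_i)` on `G = ∏_i ℤ/a_iℤ`. -/
noncomputable def gchar {r : ℕ} (a : Fin r → ℕ) (x y : ∀ i, ZMod (a i)) : ℂ :=
  Complex.exp (2 * Real.pi * Complex.I *
    ∑ i, ((x i).val : ℂ) * ((y i).val : ℂ) / (a i : ℂ))

/-- The discrete Fourier transform `f̂(x) = Σ_y f(y)·exp(−2πi·Σ_i x_i·y_i/a_i)`. -/
noncomputable def gdft {r : ℕ} (a : Fin r → ℕ) [∀ i, NeZero (a i)]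
    (f : (∀ i, ZMod (a i)) → ℂ) (x : ∀ i, ZMod (a i)) : ℂ :=
  ∑ y : ∀ i, ZMod (a i), f y * Complex.exp (-(2 * Real.pi * Complex.I *
    ∑ i, ((x i).val : ℂ) * ((y i).val : ℂ) / (a i : ℂ)))

/-- `autocorr f (x_1,…,x_m)` is the `(m+1)`-st order autocorrelation
`M_{m+1}(f; x_1,…,x_m) = Σ_y f(y)·f(y+x_1)⋯f(y+x_m)`. -/
noncomputable def autocorr {G : Type*} [AddCommGroup G] [Fintype G]
    (f : G → ℂ) {m : ℕ} (x : Fin m → G) : ℂ :=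
  ∑ y, f y * ∏ j, f (y + x j)

/-- `gdftAutocorr f (x_1,…,x_m)` is the transformed autocorrelation
`M̂_{m+1}(f; x_1,…,x_m) = f̂(x_1)⋯f̂(x_m)·f̂(−x_1−⋯−x_m)`. -/
noncomputable def gdftAutocorr {r : ℕ} (a : Fin r → ℕ) [∀ i, NeZero (a i)]
    (f : (∀ i, ZMod (a i)) → ℂ) {m : ℕ} (x : Fin m → ∀ i, ZMod (a i)) : ℂ :=
  (∏ j, gdft a f (x j)) * gdft a f (-∑ j, x j)

/-- The kernel of the transform as a product of standard additive characters. -/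
lemma exp_eq_prod_stdAddChar {r : ℕ} (a : Fin r → ℕ) [∀ i, NeZero (a i)]
    (x y : ∀ i, ZMod (a i)) :
    Complex.exp (-(2 * Real.pi * Complex.I *
      ∑ i, ((x i).val : ℂ) * ((y i).val : ℂ) / (a i : ℂ))) =
      ∏ i, ZMod.stdAddChar (-(x i * y i)) := by
  rw [Finset.mul_sum, ← Finset.sum_neg_distrib, Complex.exp_sum]
  refine Finset.prod_congr rfl fun i _ => ?_
  have h : -(x i * y i) = ((-((x i).val * (y i).val : ℤ) : ℤ) : ZMod (a i)) := by
    push_cast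
    rw [ZMod.natCast_zmod_val, ZMod.natCast_zmod_val]
  rw [h, ZMod.stdAddChar_coe]
  congr 1
  push_cast
  ring

lemma prod_stdAddChar_nsmul {r : ℕ} (a : Fin r → ℕ) [∀ i, NeZero (a i)]
    (x y : ∀ i, ZMod (a i)) (n : ℕ) :
    ∏ i, ZMod.stdAddChar (-((n • x) i * y i)) =
      (∏ i, ZMod.stdAddChar (-(x i * y i))) ^ n := by
  rw [← Finset.prod_pow]
  refine Finset.prod_congr rfl fun i _ => ?_
  rw [← AddChar.map_nsmul_eq_pow, Pi.smul_apply, smul_mul_assoc, smul_neg]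

/-- The transform of a rational-valued function is, along multiples of a point, a rational
polynomial evaluated at powers of a primitive root of unity. -/
lemma exists_polynomial_gdft_nsmul {r : ℕ} (a : Fin r → ℕ) [∀ i, NeZero (a i)]
    (f : (∀ i, ZMod (a i)) → ℂ) (hf : ∀ x, ∃ q : ℚ, f x = (q : ℂ))
    {N : ℕ} [NeZero N] (x : ∀ i, ZMod (a i)) (hx : N • x = 0)
    {ζ : ℂ} (hζ : IsPrimitiveRoot ζ N) :
    ∃ P : Polynomial ℚ, ∀ n : ℕ, gdft a f (n • x) = Polynomial.aeval (ζ ^ n) P := by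
  choose q hq using hf
  have hK (y : ∀ i, ZMod (a i)) :
      ∃ e : ℕ, ζ ^ e = ∏ i, ZMod.stdAddChar (-(x i * y i)) := by
    obtain ⟨e, -, he⟩ := hζ.eq_pow_of_pow_eq_one
      (ξ := ∏ i, ZMod.stdAddChar (-(x i * y i)))
      (by rw [← prod_stdAddChar_nsmul, hx]; simp)
    exact ⟨e, he⟩
  choose e he using hK
  refine ⟨∑ y, Polynomial.C (q y) * Polynomial.X ^ e y, fun n => ?_⟩
  simp only [gdft, exp_eq_prod_stdAddChar, prod_stdAddChar_nsmul, map_sum, map_mul, map_pow,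
    Polynomial.aeval_C, Polynomial.aeval_X, ← he, hq]
  refine Finset.sum_congr rfl fun y _ => ?_
  rw [← pow_mul, ← pow_mul, mul_comm n]
  simp

lemma gdft_nsmul_ne_zero {r : ℕ} (a : Fin r → ℕ) [∀ i, NeZero (a i)]
    (f : (∀ i, ZMod (a i)) → ℂ) (hf : ∀ x, ∃ q : ℚ, f x = (q : ℂ))
    {N : ℕ} [NeZero N] {x : ∀ i, ZMod (a i)} (hN : N • x = 0) (hx : gdft a f x ≠ 0)
    {n : ℕ} (hn : n.Coprime N) : gdft a f (n • x) ≠ 0 := by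
  have hζ := Complex.isPrimitiveRoot_exp N (NeZero.ne N)
  obtain ⟨P, hP⟩ := exists_polynomial_gdft_nsmul a f hf x hN hζ
  intro h0
  rw [hP] at h0
  refine hx ?_
  have hdvd := minpoly.dvd ℚ _ h0
  rw [← Polynomial.cyclotomic_eq_minpoly_rat (hζ.pow_of_coprime n hn) (NeZero.pos N),
    Polynomial.cyclotomic_eq_minpoly_rat hζ (NeZero.pos N)] at hdvd
  obtain ⟨Q, rfl⟩ := hdvd
  have h1 := hP 1
  rwa [one_smul, pow_one, map_mul, minpoly.aeval, zero_mul] at h1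

lemma gdft_zsmul_ne_zero {r : ℕ} (a : Fin r → ℕ) [∀ i, NeZero (a i)]
    (f : (∀ i, ZMod (a i)) → ℂ) (hf : ∀ x, ∃ q : ℚ, f x = (q : ℂ))
    {N : ℕ} [NeZero N] {x : ∀ i, ZMod (a i)} (hN : N • x = 0) (hx : gdft a f x ≠ 0)
    {c : ℤ} (hc : IsCoprime c (N : ℤ)) : gdft a f (c • x) ≠ 0 := by
  have hN0 : (N : ℤ) ≠ 0 := by exact_mod_cast NeZero.ne N
  obtain ⟨n, hn⟩ := Int.eq_ofNat_of_zero_le (Int.emod_nonneg c hN0)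
  have hcn : c = n + N * (c / N) := by rw [← hn]; exact (Int.emod_add_mul_ediv c N).symm
  have hcop : n.Coprime N := by
    rw [← Nat.isCoprime_iff_coprime]
    rw [hcn] at hc
    exact (IsCoprime.add_mul_left_left_iff (z := c / N)).1 hc
  have hsmul : c • x = n • x := by
    rw [hcn, add_smul, mul_comm, mul_smul, natCast_zsmul, natCast_zsmul, hN, smul_zero, add_zero]
  rw [hsmul]
  exact gdft_nsmul_ne_zero a f hf hN hx hcop

lemma prod_Icc_sq_div_succ_pow {K : Type*} [Field K] (F : ℕ → K) (hF : ∀ k, 1 ≤ k → F k ≠ 0)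
    (n : ℕ) :
    ∏ k ∈ Finset.Icc 1 n, (F k ^ 2 / F (k + 1)) ^ 2 ^ (n - k) = F 1 ^ 2 ^ n / F (n + 1) := by
  induction n with
  | zero => simp [div_self (hF 1 le_rfl)]
  | succ n ih =>
    have h : ∏ k ∈ Finset.Icc 1 n, (F k ^ 2 / F (k + 1)) ^ 2 ^ (n + 1 - k) =
        (F 1 ^ 2 ^ n / F (n + 1)) ^ 2 := by
      rw [← ih, ← Finset.prod_pow]
      refine Finset.prod_congr rfl fun k hk => ?_
      rw [← pow_mul, ← pow_succ, Nat.succ_sub (Finset.mem_Icc.1 hk).2]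
    rw [Finset.prod_Icc_succ_top (by lia), h, Nat.sub_self, pow_zero, pow_one, div_pow,
      ← pow_mul, ← pow_succ]
    have := hF (n + 1) (by lia)
    field_simp

theorem stmt7 {r : ℕ} (hr : 1 ≤ r) (a : Fin r → ℕ) [∀ i, NeZero (a i)]
    (f : (∀ i, ZMod (a i)) → ℂ) (hf : ∀ x, ∃ q : ℚ, f x = (q : ℂ))
    (N : ℕ) (hN : N = AddMonoid.exponent (∀ i, ZMod (a i))) (heven : Even N)
    (m : ℕ) (hm1 : 1 ≤ m) (hm2 : 2 ^ m ∣ N) (hm3 : ¬ 2 ^ (m + 1) ∣ N)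
    (l : ℕ) (hl : l = Nat.totient (N / 2 ^ m))
    (u v : ℕ → ℕ)
    (hu : ∀ k, 1 ≤ k → Nat.Coprime (u k) N)
    (hv : ∀ k, 1 ≤ k → Nat.Coprime (v k) N)
    (huv : ∀ k, 1 ≤ k → u k + v k ≡ 2 ^ k [MOD N])
    (hu1 : u 1 = 1) (hv1 : v 1 = 1)
    (hup : ∀ k, m ≤ k → u (k + l) ≡ u k [MOD N])
    (hvp : ∀ k, m ≤ k → v (k + l) ≡ v k [MOD N])
    (x : ∀ i, ZMod (a i)) (hx : gdft a f x ≠ 0) :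
    (∀ c : ℤ, IsCoprime c (N : ℤ) → gdft a f (c • x) ≠ 0) ∧
      gdft a f x ^ (2 ^ m * (2 ^ l - 1)) =
        (∏ k ∈ Finset.Icc 1 (l + m - 1),
            (gdftAutocorr a f
                ![(u k) • x, (v k) • x, (u k) • x, (v k) • x, -((u (k + 1)) • x)] /
              gdftAutocorr a f
                ![(u (k + 1)) • x, (v (k + 1)) • x, -((u (k + 1)) • x)]) ^
              (2 ^ (l + m - 1 - k))) /
        (∏ k ∈ Finset.Icc 1 (m - 1),
            (gdftAutocorr a f
                ![(u k) • x, (v k) • x, (u k) • x, (v k) • x, -((u (k + 1)) • x)] /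
              gdftAutocorr a f
                ![(u (k + 1)) • x, (v (k + 1)) • x, -((u (k + 1)) • x)]) ^
              (2 ^ (m - 1 - k))) := by
  have : NeZero N := ⟨hN ▸ AddMonoid.exponent_ne_zero_of_finite⟩
  have hNx : N • x = 0 := hN ▸ AddMonoid.exponent_nsmul_eq_zero x
  have hconj (c : ℤ) (hc : IsCoprime c (N : ℤ)) : gdft a f (c • x) ≠ 0 :=
    gdft_zsmul_ne_zero a f hf hNx hx hc
  refine ⟨hconj, ?_⟩
  have hsmul {s t : ℕ} (h : s ≡ t [MOD N]) : s • x = t • x :=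
    nsmul_eq_nsmul_iff_modEq.2 (h.of_dvd (addOrderOf_dvd_of_nsmul_eq_zero hNx))
  have hpos {s : ℕ} (h : s.Coprime N) : gdft a f (s • x) ≠ 0 := by
    simpa using hconj s (Nat.isCoprime_iff_coprime.2 h)
  have hneg {s : ℕ} (h : s.Coprime N) : gdft a f (-(s • x)) ≠ 0 := by
    simpa using hconj (-s) (Nat.isCoprime_iff_coprime.2 h).neg_left
  set F : ℕ → ℂ := fun k => gdft a f (u k • x) * gdft a f (v k • x) with hFdef
  have hF (k : ℕ) (hk : 1 ≤ k) : F k ≠ 0 := mul_ne_zero (hpos (hu k hk)) (hpos (hv k hk))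
  have hquot (k : ℕ) (hk : 1 ≤ k) :
      gdftAutocorr a f ![(u k) • x, (v k) • x, (u k) • x, (v k) • x, -((u (k + 1)) • x)] /
        gdftAutocorr a f ![(u (k + 1)) • x, (v (k + 1)) • x, -((u (k + 1)) • x)] =
      F k ^ 2 / F (k + 1) := by
    have hk1 : 1 ≤ k + 1 := by lia
    have h1 : u k • x + v k • x = 2 ^ k • x := by rw [← add_smul, hsmul (huv k hk)]
    have h2 : u (k + 1) • x + v (k + 1) • x = 2 ^ k • x + 2 ^ k • x := by
      rw [← add_smul, hsmul (huv _ hk1), ← add_smul, pow_succ, mul_two]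
    have hB : -(u k • x + (v k • x + (u k • x + (v k • x + -(u (k + 1) • x))))) =
        -(v (k + 1) • x) := by
      rw [neg_inj, ← add_assoc, ← add_assoc, ← add_assoc, h1, add_assoc (2 ^ k • x), h1, ← h2]
      abel
    have hA : -(u (k + 1) • x + (v (k + 1) • x + -(u (k + 1) • x))) = -(v (k + 1) • x) := by
      abel
    have := hpos (hu _ hk1)
    have := hpos (hv _ hk1)
    have := hneg (hu _ hk1)
    have := hneg (hv _ hk1)
    simp only [gdftAutocorr, Fin.prod_univ_succ, Fin.sum_univ_succ, Matrix.cons_val_zero,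
      Matrix.cons_val_succ, Finset.univ_eq_empty, Finset.prod_empty, Finset.sum_empty,
      mul_one, add_zero, hA, hB, hFdef]
    field_simp
  have hprod (n : ℕ) := Finset.prod_congr (rfl : Finset.Icc 1 n = _) fun k hk =>
    congrArg (· ^ 2 ^ (n - k)) (hquot k (Finset.mem_Icc.1 hk).1)
  rw [hprod, hprod, prod_Icc_sq_div_succ_pow F hF, prod_Icc_sq_div_succ_pow F hF]
  have hper : F (l + m - 1 + 1) = F (m - 1 + 1) := by
    rw [Nat.sub_add_cancel (by lia), Nat.sub_add_cancel hm1, add_comm]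
    simp only [hFdef, hsmul (hup m le_rfl), hsmul (hvp m le_rfl)]
  have hF1 : F 1 = gdft a f x ^ 2 := by simp [hFdef, hu1, hv1, sq]
  rw [hper, hF1, div_div_div_cancel_right₀ (hF _ (by lia)), ← pow_mul, ← pow_mul, ← pow_succ',
    ← pow_succ', Nat.sub_add_cancel (by lia), Nat.sub_add_cancel hm1,
    eq_div_iff (pow_ne_zero _ hx), ← pow_add]
  congr 1
  rw [Nat.mul_sub, mul_one, ← pow_add, add_comm m l,
    Nat.sub_add_cancel (Nat.pow_le_pow_right two_pos (by lia))]
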